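/- Let λ > 0, δ ≥ 0, α > 0, T > 0, and let s : [0,T] → (0,1) be twice continuously differentiable with −α < ṡ(t) < 0 for all t. Let c be twice continuously differentiable on D_T = {(x,t) : 0 ≤ t ≤ T, s(t) ≤ x ≤ 1} and suppose: (i) c_tt = α²·c_xx on D_T; (ii) 2λ·ṡ(t) = −( c(s(t),t) − δ )₊ for all t; and (iii) −α²·c_x(s(t),t) = s̈(t)·( c(s(t),t) + λ ) + ṡ(t)²·c_x(s(t),t) + 2·ṡ(t)·c_t(s(t),t) for all t. Define u(x,t) = λ·(x − s(t)) + ∫_{s(t)}^{x} c(η,t) dη. Then u is twice continuously differentiable on D_T and satisfies: u_tt = α²·u_xx on D_T; u(s(t),t) = 0 for all t; u_x(x,t) = c(x,t) + λ on D_T; and 2λ·ṡ(t) = −( u_x(s(t),t) − λ − δ )₊ for all t. -/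

import Mathlib

open MeasureTheory intervalIntegral

/-!
STATEMENT 19: The transformation `u(x,t) = λ(x − s(t)) + ∫_{s(t)}^x c(η,t) dη`
converts a classical solution `(c,s)` of the reduced free boundary problem
(wave equation `c_tt = α² c_xx`, kinetic condition `2λṡ = −(c(s,t) − δ)₊`,
and the free boundary condition (iii)) into a solution of the Stefan-like
problem: `u` is C² on `D_T`, satisfies `u_tt = α² u_xx`, `u(s(t),t) = 0`,
`u_x = c + λ`, and `2λṡ = −(u_x(s,t) − λ − δ)₊`.
Here `(y)₊ = max y 0`; `c` is C² on an open neighbourhood `U` of the region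
`D_T = {(x,t) : 0 ≤ t ≤ T, s(t) ≤ x ≤ 1}`, and `s` is C² on an open
neighbourhood `V` of `[0,T]`; points of `ℝ²` are pairs `(x,t)`.
-/

/-- Partial derivative with respect to the first (space) variable. -/
noncomputable def pderivX (f : ℝ × ℝ → ℝ) (p : ℝ × ℝ) : ℝ :=
  deriv (fun x => f (x, p.2)) p.1

/-- Partial derivative with respect to the second (time) variable. -/
noncomputable def pderivT (f : ℝ × ℝ → ℝ) (p : ℝ × ℝ) : ℝ :=
  deriv (fun t => f (p.1, t)) p.2

/-- The transform `u(x,t) = λ(x − s(t)) + ∫_{s(t)}^x c(η,t) dη`. -/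
noncomputable def transformU (lam : ℝ) (s : ℝ → ℝ) (c : ℝ × ℝ → ℝ) (p : ℝ × ℝ) : ℝ :=
  lam * (p.1 - s p.2) + ∫ η in (s p.2)..p.1, c (η, p.2)

section TransformHelpers

open Set Filter Topology

/-- Smooth extension of a `C²` function from a neighbourhood of a closed set. -/
lemma exists_global_ext {E : Type*} [NormedAddCommGroup E] [NormedSpace ℝ E]
    [FiniteDimensional ℝ E] {f : E → ℝ} {U K : Set E} (hU : IsOpen U) (hK : IsClosed K)
    (hKU : K ⊆ U) (hf : ContDiffOn ℝ 2 f U) :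
    ∃ g : E → ℝ, ContDiff ℝ 2 g ∧ ∀ x ∈ K, f =ᶠ[𝓝 x] g := by
  obtain ⟨χ, h0, h1, -⟩ := exists_contMDiffMap_zero_one_nhds_of_isClosed
    (modelWithCornersSelf ℝ E) (n := 2) hU.isClosed_compl hK
    (Set.disjoint_left.2 fun x hx hx' => hx (hKU hx'))
  have hχ : ContDiff ℝ 2 χ := χ.contMDiff.contDiff
  refine ⟨fun x => χ x * f x, ?_, ?_⟩
  · rw [contDiff_iff_contDiffAt]
    intro x
    by_cases hx : x ∈ U
    · exact hχ.contDiffAt.mul (hf.contDiffAt (hU.mem_nhds hx))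
    · have : (fun x => χ x * f x) =ᶠ[𝓝 x] fun _ => 0 := by
        filter_upwards [mem_nhdsSet_iff_forall.1 h0 x hx] with y hy
        have hy' : χ y = 0 := hy
        simp [hy']
      exact contDiffAt_const.congr_of_eventuallyEq this
  · intro x hx
    filter_upwards [mem_nhdsSet_iff_forall.1 h1 x hx] with y hy
    have hy' : χ y = 1 := hy
    simp [hy']

/-- Primitive in the space variable. -/
noncomputable def primX (g : ℝ × ℝ → ℝ) (p : ℝ × ℝ) : ℝ := ∫ η in (0 : ℝ)..p.1, g (η, p.2)

lemma pderivX_hasDerivAt {g : ℝ × ℝ → ℝ} (hg : Differentiable ℝ g) (x t : ℝ) :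
    HasDerivAt (fun x => g (x, t)) (fderiv ℝ g (x, t) (1, 0)) x :=
  (hg (x, t)).hasFDerivAt.comp_hasDerivAt x ((hasDerivAt_id x).prodMk (hasDerivAt_const x t))

lemma pderivT_hasDerivAt {g : ℝ × ℝ → ℝ} (hg : Differentiable ℝ g) (x t : ℝ) :
    HasDerivAt (fun t => g (x, t)) (fderiv ℝ g (x, t) (0, 1)) t :=
  (hg (x, t)).hasFDerivAt.comp_hasDerivAt t ((hasDerivAt_const t x).prodMk (hasDerivAt_id t))

lemma pderivX_eq {g : ℝ × ℝ → ℝ} (hg : Differentiable ℝ g) :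
    pderivX g = fun p => fderiv ℝ g p (1, 0) := by
  ext ⟨x, t⟩; exact (pderivX_hasDerivAt hg x t).deriv

lemma pderivT_eq {g : ℝ × ℝ → ℝ} (hg : Differentiable ℝ g) :
    pderivT g = fun p => fderiv ℝ g p (0, 1) := by
  ext ⟨x, t⟩; exact (pderivT_hasDerivAt hg x t).deriv

lemma hasDerivAt_pX {g : ℝ × ℝ → ℝ} (hg : Differentiable ℝ g) (x t : ℝ) :
    HasDerivAt (fun x => g (x, t)) (pderivX g (x, t)) x := by
  rw [pderivX_eq hg]; exact pderivX_hasDerivAt hg x t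

lemma hasDerivAt_pT {g : ℝ × ℝ → ℝ} (hg : Differentiable ℝ g) (x t : ℝ) :
    HasDerivAt (fun t => g (x, t)) (pderivT g (x, t)) t := by
  rw [pderivT_eq hg]; exact pderivT_hasDerivAt hg x t

lemma contDiff_pX {n : ℕ} {g : ℝ × ℝ → ℝ} (hg : ContDiff ℝ (n + 1) g) :
    ContDiff ℝ n (pderivX g) := by
  rw [pderivX_eq (hg.differentiable (by simp))]
  exact (hg.fderiv_right le_rfl).clm_apply contDiff_const

lemma contDiff_pT {n : ℕ} {g : ℝ × ℝ → ℝ} (hg : ContDiff ℝ (n + 1) g) :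
    ContDiff ℝ n (pderivT g) := by
  rw [pderivT_eq (hg.differentiable (by simp))]
  exact (hg.fderiv_right le_rfl).clm_apply contDiff_const

lemma continuous_primX {g : ℝ × ℝ → ℝ} (hg : Continuous g) : Continuous (primX g) := by
  unfold primX
  exact intervalIntegral.continuous_parametric_intervalIntegral_of_continuous
    (f := fun (p : ℝ × ℝ) η => g (η, p.2)) (by fun_prop) continuous_fst

lemma hasDerivAt_primX_fst {g : ℝ × ℝ → ℝ} (hg : Continuous g) (x t : ℝ) :
    HasDerivAt (fun x => primX g (x, t)) (g (x, t)) x := by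
  have h : Continuous fun η => g (η, t) := by fun_prop
  exact intervalIntegral.integral_hasDerivAt_right (h.intervalIntegrable _ _)
    (h.stronglyMeasurableAtFilter _ _) h.continuousAt

lemma hasDerivAt_primX_snd {g : ℝ × ℝ → ℝ} (hg : ContDiff ℝ 1 g) (x t : ℝ) :
    HasDerivAt (fun t => primX g (x, t)) (primX (pderivT g) (x, t)) t := by
  have hd : Differentiable ℝ g := hg.differentiable (by simp)
  have hc : Continuous (pderivT g) := (contDiff_pT (n := 0) (by simpa using hg)).continuous
  obtain ⟨M, hM⟩ := ((isCompact_uIcc (a := (0:ℝ)) (b := x)).prod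
    (isCompact_closedBall t 1)).exists_bound_of_continuousOn hc.continuousOn
  have hgc := hg.continuous
  refine (intervalIntegral.hasDerivAt_integral_of_dominated_loc_of_deriv_le
    (F := fun t η => g (η, t)) (F' := fun t η => pderivT g (η, t)) (bound := fun _ => M)
    (Metric.closedBall_mem_nhds t one_pos) (Eventually.of_forall fun t => ?_) ?_ ?_ ?_ ?_ ?_).2
  · exact (by fun_prop : Continuous fun η => g (η, t)).aestronglyMeasurable
  · exact (by fun_prop : Continuous fun η => g (η, t)).intervalIntegrable _ _
  · exact (by fun_prop : Continuous fun η => pderivT g (η, t)).aestronglyMeasurable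
  · exact Eventually.of_forall fun η hη y hy => hM (η, y) ⟨uIoc_subset_uIcc hη, hy⟩
  · exact intervalIntegrable_const
  · exact Eventually.of_forall fun η hη y hy => hasDerivAt_pT hd η y

lemma hasFDerivAt_primX {g : ℝ × ℝ → ℝ} (hg : ContDiff ℝ 1 g) (p : ℝ × ℝ) :
    HasFDerivAt (primX g) (g p • ContinuousLinearMap.fst ℝ ℝ ℝ
      + primX (pderivT g) p • ContinuousLinearMap.snd ℝ ℝ ℝ) p := by
  have hgc := hg.continuous
  have hc : Continuous (pderivT g) := (contDiff_pT (n := 0) (by simpa using hg)).continuous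
  have hc2 := continuous_primX hc
  have := (hasStrictFDerivAt_uncurry_coprod (𝕜 := ℝ) (u := p) (f := fun x t => primX g (x, t))
    (f₁ := fun x t => ContinuousLinearMap.toSpanSingleton ℝ (g (x, t)))
    (f₂ := fun x t => ContinuousLinearMap.toSpanSingleton ℝ (primX (pderivT g) (x, t)))
    (Eventually.of_forall fun v => (hasDerivAt_primX_fst hgc v.1 v.2).hasFDerivAt)
    (Eventually.of_forall fun v => (hasDerivAt_primX_snd hg v.1 v.2).hasFDerivAt)
    ?_ ?_).hasFDerivAt
  · refine HasFDerivAt.congr_fderiv this ?_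
    ext <;> simp [Function.HasUncurry.uncurry]
  · apply Continuous.continuousAt
    exact (ContinuousLinearMap.toSpanSingletonCLE (𝕜 := ℝ) (E := ℝ)).continuous.comp hgc
  · apply Continuous.continuousAt
    exact (ContinuousLinearMap.toSpanSingletonCLE (𝕜 := ℝ) (E := ℝ)).continuous.comp hc2

lemma contDiff_primX (n : ℕ) : ∀ {g : ℝ × ℝ → ℝ}, ContDiff ℝ n g → ContDiff ℝ n (primX g) := by
  induction n with
  | zero =>
    intro g hg
    exact contDiff_zero.2 (continuous_primX hg.continuous)
  | succ n ih =>
    intro g hg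
    push_cast at hg ⊢
    have h1 : ContDiff ℝ 1 g := hg.of_le (by simp)
    rw [contDiff_succ_iff_hasFDerivAt]
    refine ⟨_, ?_, hasFDerivAt_primX h1⟩
    have h2 : ContDiff ℝ n g := hg.of_le (by simp)
    exact (h2.smul contDiff_const).add ((ih (contDiff_pT hg)).smul contDiff_const)

lemma transformU_eq {lam : ℝ} {s : ℝ → ℝ} {c : ℝ × ℝ → ℝ} (hc : Continuous c) :
    transformU lam s c = fun p => lam * (p.1 - s p.2) + (primX c p - primX c (s p.2, p.2)) := by
  ext p
  have h : Continuous fun η => c (η, p.2) := by fun_prop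
  simp only [transformU, primX]
  rw [intervalIntegral.integral_interval_sub_left (h.intervalIntegrable _ _)
    (h.intervalIntegrable _ _)]

lemma hasDerivAt_along {g : ℝ × ℝ → ℝ} (hg : Differentiable ℝ g) {s : ℝ → ℝ} {s' t : ℝ}
    (hs : HasDerivAt s s' t) :
    HasDerivAt (fun t => g (s t, t)) (s' * pderivX g (s t, t) + pderivT g (s t, t)) t := by
  have h := HasFDerivAt.comp_hasDerivAt (f := fun t => (s t, t)) t (hg (s t, t)).hasFDerivAt
    (hs.prodMk (hasDerivAt_id t))
  rw [pderivX_eq hg, pderivT_eq hg]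
  refine HasDerivAt.congr_deriv h ?_
  have : ((s', 1) : ℝ × ℝ) = s' • (1, 0) + (0, 1) := by simp
  rw [this, map_add, map_smul]; simp

lemma pX_primX {g : ℝ × ℝ → ℝ} (hg : Continuous g) : pderivX (primX g) = g := by
  ext ⟨x, t⟩; exact (hasDerivAt_primX_fst hg x t).deriv

lemma pT_primX {g : ℝ × ℝ → ℝ} (hg : ContDiff ℝ 1 g) :
    pderivT (primX g) = primX (pderivT g) := by
  ext ⟨x, t⟩; exact (hasDerivAt_primX_snd hg x t).deriv

lemma global_pX {lam : ℝ} {s : ℝ → ℝ} {c : ℝ × ℝ → ℝ} (hc : Continuous c) :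
    pderivX (transformU lam s c) = fun p => c p + lam := by
  ext ⟨x, t⟩
  rw [transformU_eq hc]
  refine HasDerivAt.deriv ?_
  have := (((hasDerivAt_id x).sub_const (s t)).const_mul lam).add
    ((hasDerivAt_primX_fst hc x t).sub_const (primX c (s t, t)))
  refine HasDerivAt.congr_deriv this ?_
  try simp only []
  ring

lemma global_pT {lam : ℝ} {s : ℝ → ℝ} {c : ℝ × ℝ → ℝ} (hc : ContDiff ℝ 2 c)
    (hs : ContDiff ℝ 2 s) :
    pderivT (transformU lam s c) = fun p => -(lam + c (s p.2, p.2)) * deriv s p.2 +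
      (primX (pderivT c) p - primX (pderivT c) (s p.2, p.2)) := by
  ext ⟨x, t⟩
  have h1 : ContDiff ℝ 1 c := hc.of_le (by norm_num)
  have hs1 : HasDerivAt s (deriv s t) t := (hs.differentiable (by simp) t).hasDerivAt
  rw [transformU_eq hc.continuous]
  refine HasDerivAt.deriv ?_
  have hP : Differentiable ℝ (primX c) := fun p => (hasFDerivAt_primX h1 p).differentiableAt
  have := ((hs1.const_sub x).const_mul lam).add
    ((hasDerivAt_primX_snd h1 x t).sub (hasDerivAt_along hP hs1))
  rw [pX_primX hc.continuous, pT_primX h1] at this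
  refine HasDerivAt.congr_deriv this ?_
  try simp only []
  ring

lemma global_pTT {lam : ℝ} {s : ℝ → ℝ} {c : ℝ × ℝ → ℝ} (hc : ContDiff ℝ 2 c)
    (hs : ContDiff ℝ 2 s) (x t : ℝ) :
    pderivT (pderivT (transformU lam s c)) (x, t) =
      -(lam + c (s t, t)) * deriv (deriv s) t - (deriv s t) ^ 2 * pderivX c (s t, t)
      - 2 * deriv s t * pderivT c (s t, t) + ∫ η in (s t)..x, pderivT (pderivT c) (η, t) := by
  have hct : ContDiff ℝ 1 (pderivT c) := contDiff_pT (n := 1) (by simpa [one_add_one_eq_two])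
  have hs1 : HasDerivAt s (deriv s t) t := (hs.differentiable (by simp) t).hasDerivAt
  have hs' : ContDiff ℝ 1 (deriv s) := by
    have : ContDiff ℝ (1 + 1) s := by simpa [one_add_one_eq_two]
    exact (contDiff_succ_iff_deriv.1 this).2.2
  have hs2 : HasDerivAt (deriv s) (deriv (deriv s) t) t :=
    (hs'.differentiable (by simp) t).hasDerivAt
  have hctt : Continuous (pderivT (pderivT c)) :=
    (contDiff_pT (n := 0) (by simpa using hct)).continuous
  rw [global_pT hc hs]
  refine HasDerivAt.deriv ?_
  have hP : Differentiable ℝ (primX (pderivT c)) :=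
    fun p => (hasFDerivAt_primX hct p).differentiableAt
  have hcd : Differentiable ℝ c := hc.differentiable (by simp)
  have := ((((hasDerivAt_along hcd hs1).const_add lam).neg).mul hs2).add
    ((hasDerivAt_primX_snd hct x t).sub (hasDerivAt_along hP hs1))
  rw [pX_primX hct.continuous, pT_primX hct] at this
  refine HasDerivAt.congr_deriv this ?_
  have h : Continuous fun η => pderivT (pderivT c) (η, t) := by fun_prop
  rw [← intervalIntegral.integral_interval_sub_left (h.intervalIntegrable 0 x)
    (h.intervalIntegrable 0 (s t))]
  simp only [primX, Pi.neg_apply]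
  ring

lemma global_contDiff {lam : ℝ} {s : ℝ → ℝ} {c : ℝ × ℝ → ℝ} (hc : ContDiff ℝ 2 c)
    (hs : ContDiff ℝ 2 s) : ContDiff ℝ 2 (transformU lam s c) := by
  rw [transformU_eq hc.continuous]
  have hP : ContDiff ℝ 2 (primX c) := contDiff_primX 2 hc
  have h2 : ContDiff ℝ 2 (fun p : ℝ × ℝ => s p.2) := hs.comp contDiff_snd
  exact (contDiff_const.mul (contDiff_fst.sub h2)).add
    (hP.sub (hP.comp (h2.prodMk contDiff_snd)))

lemma pX_congr {f g : ℝ × ℝ → ℝ} {p : ℝ × ℝ} (h : f =ᶠ[𝓝 p] g) :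
    pderivX f =ᶠ[𝓝 p] pderivX g := by
  filter_upwards [h.eventuallyEq_nhds] with q hq
  refine Filter.EventuallyEq.deriv_eq ?_
  have : Tendsto (fun x => (x, q.2)) (𝓝 q.1) (𝓝 q) :=
    (by fun_prop : Continuous fun x : ℝ => (x, q.2)).tendsto' _ _ rfl
  exact this.eventually hq

lemma pT_congr {f g : ℝ × ℝ → ℝ} {p : ℝ × ℝ} (h : f =ᶠ[𝓝 p] g) :
    pderivT f =ᶠ[𝓝 p] pderivT g := by
  filter_upwards [h.eventuallyEq_nhds] with q hq
  refine Filter.EventuallyEq.deriv_eq ?_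
  have : Tendsto (fun t => (q.1, t)) (𝓝 q.2) (𝓝 q) :=
    (by fun_prop : Continuous fun t : ℝ => (q.1, t)).tendsto' _ _ rfl
  exact this.eventually hq

lemma transformU_congr {lam : ℝ} {s s₁ : ℝ → ℝ} {c c₁ : ℝ × ℝ → ℝ} {x t : ℝ}
    (hs₁ : Continuous s₁) (hs : s =ᶠ[𝓝 t] s₁)
    (hc : ∀ η ∈ uIcc (s t) x, c =ᶠ[𝓝 (η, t)] c₁) :
    transformU lam s c =ᶠ[𝓝 (x, t)] transformU lam s₁ c₁ := by
  obtain ⟨A, B, hA, hB, hKA, htB, hAB⟩ := generalized_tube_lemma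
    (isCompact_uIcc (a := s t) (b := x)) (isCompact_singleton (x := t))
    (isOpen_setOfPred_eventually_nhds (p := fun q => c q = c₁ q)) (by
      rintro ⟨η, t'⟩ ⟨hη, rfl⟩
      exact hc η hη)
  obtain ⟨ε, hε, hεA⟩ := isCompact_uIcc.exists_thickening_subset_open hA hKA
  have hconv : (Metric.thickening ε (uIcc (s t) x)).OrdConnected :=
    ((convex_uIcc (s t) x).thickening ε).ordConnected
  have hopen : IsOpen (Metric.thickening ε (uIcc (s t) x)) := Metric.isOpen_thickening
  have hsub := Metric.self_subset_thickening hε (uIcc (s t) x)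
  have hst : s t = s₁ t := hs.self_of_nhds
  have e1 : ∀ᶠ q : ℝ × ℝ in 𝓝 (x, t), q.1 ∈ Metric.thickening ε (uIcc (s t) x) :=
    continuous_fst.continuousAt.eventually (hopen.mem_nhds (hsub right_mem_uIcc))
  have e2 : ∀ᶠ q : ℝ × ℝ in 𝓝 (x, t), s₁ q.2 ∈ Metric.thickening ε (uIcc (s t) x) := by
    refine (hs₁.comp continuous_snd).continuousAt.eventually (hopen.mem_nhds (hsub ?_))
    simp only [Function.comp, ← hst]
    exact left_mem_uIcc
  have e3 : ∀ᶠ q : ℝ × ℝ in 𝓝 (x, t), q.2 ∈ B :=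
    continuous_snd.continuousAt.eventually (hB.mem_nhds (htB rfl))
  have e4 : ∀ᶠ q : ℝ × ℝ in 𝓝 (x, t), s q.2 = s₁ q.2 :=
    (continuous_snd.tendsto (x, t)).eventually hs
  filter_upwards [e1, e2, e3, e4] with q h1 h2 h3 h4
  simp only [transformU, h4]
  congr 1
  refine intervalIntegral.integral_congr fun η hη => ?_
  have hm : (η, q.2) ∈ A ×ˢ B := ⟨hεA (hconv.uIcc_subset h2 h1 hη), h3⟩
  exact (hAB hm).self_of_nhds

end TransformHelpers

theorem transform_to_stefan_like_problem (lam δ α T : ℝ)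
    (s s' s'' : ℝ → ℝ) (c : ℝ × ℝ → ℝ) (U : Set (ℝ × ℝ)) (V : Set ℝ)
    (hlam : 0 < lam) (hδ : 0 ≤ δ) (hα : 0 < α) (hT : 0 < T)
    (hrange : ∀ t ∈ Set.Icc (0 : ℝ) T, s t ∈ Set.Ioo (0 : ℝ) 1)
    (hV : IsOpen V) (hVi : Set.Icc (0 : ℝ) T ⊆ V)
    (hsC2 : ContDiffOn ℝ 2 s V)
    (hs' : ∀ t ∈ Set.Icc (0 : ℝ) T, HasDerivAt s (s' t) t)
    (hs'' : ∀ t ∈ Set.Icc (0 : ℝ) T, HasDerivAt s' (s'' t) t)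
    (hsb : ∀ t ∈ Set.Icc (0 : ℝ) T, -α < s' t ∧ s' t < 0)
    (hU : IsOpen U)
    (hUR : {p : ℝ × ℝ | 0 ≤ p.2 ∧ p.2 ≤ T ∧ s p.2 ≤ p.1 ∧ p.1 ≤ 1} ⊆ U)
    (hc : ContDiffOn ℝ 2 c U)
    -- (i) the wave equation for `c`
    (hwave : ∀ p ∈ {p : ℝ × ℝ | 0 ≤ p.2 ∧ p.2 ≤ T ∧ s p.2 ≤ p.1 ∧ p.1 ≤ 1},
      pderivT (pderivT c) p = α ^ 2 * pderivX (pderivX c) p)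
    -- (ii) the kinetic condition at the free boundary
    (hkinetic : ∀ t ∈ Set.Icc (0 : ℝ) T,
      2 * lam * s' t = -max (c (s t, t) - δ) 0)
    -- (iii) the free boundary condition
    (hfb : ∀ t ∈ Set.Icc (0 : ℝ) T,
      -α ^ 2 * pderivX c (s t, t)
        = s'' t * (c (s t, t) + lam) + (s' t) ^ 2 * pderivX c (s t, t)
          + 2 * s' t * pderivT c (s t, t)) :
    ContDiffOn ℝ 2 (transformU lam s c)
        {p : ℝ × ℝ | 0 ≤ p.2 ∧ p.2 ≤ T ∧ s p.2 ≤ p.1 ∧ p.1 ≤ 1} ∧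
    (∀ p ∈ {p : ℝ × ℝ | 0 ≤ p.2 ∧ p.2 ≤ T ∧ s p.2 ≤ p.1 ∧ p.1 ≤ 1},
      pderivT (pderivT (transformU lam s c)) p
        = α ^ 2 * pderivX (pderivX (transformU lam s c)) p) ∧
    (∀ t ∈ Set.Icc (0 : ℝ) T, transformU lam s c (s t, t) = 0) ∧
    (∀ p ∈ {p : ℝ × ℝ | 0 ≤ p.2 ∧ p.2 ≤ T ∧ s p.2 ≤ p.1 ∧ p.1 ≤ 1},
      pderivX (transformU lam s c) p = c p + lam) ∧
    (∀ t ∈ Set.Icc (0 : ℝ) T,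
      2 * lam * s' t = -max (pderivX (transformU lam s c) (s t, t) - lam - δ) 0) := by
  have hclosedI : IsClosed (Set.Icc (0 : ℝ) T) := isClosed_Icc
  obtain ⟨s₁, hs₁, hss⟩ := exists_global_ext hV hclosedI hVi hsC2
  set D : Set (ℝ × ℝ) := {p : ℝ × ℝ | 0 ≤ p.2 ∧ p.2 ≤ T ∧ s p.2 ≤ p.1 ∧ p.1 ≤ 1} with hD
  have hseq : ∀ t ∈ Set.Icc (0 : ℝ) T, s t = s₁ t := fun t ht => (hss t ht).self_of_nhds
  have hs₁c := hs₁.continuous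
  have hDclosed : IsClosed D := by
    have : D = {p : ℝ × ℝ | 0 ≤ p.2} ∩ ({p | p.2 ≤ T} ∩ ({p | s₁ p.2 ≤ p.1} ∩ {p | p.1 ≤ 1})) := by
      ext p
      constructor
      · rintro ⟨h1, h2, h3, h4⟩
        exact ⟨h1, h2, by simpa [← hseq p.2 ⟨h1, h2⟩] using h3, h4⟩
      · rintro ⟨h1, h2, h3, h4⟩
        refine ⟨h1, h2, ?_, h4⟩
        rw [hseq p.2 ⟨h1, h2⟩]; exact h3
    rw [this]
    exact (isClosed_le continuous_const continuous_snd).inter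
      ((isClosed_le continuous_snd continuous_const).inter
        ((isClosed_le (hs₁c.comp continuous_snd) continuous_fst).inter
          (isClosed_le continuous_fst continuous_const)))
  obtain ⟨c₁, hc₁, hcc⟩ := exists_global_ext hU hDclosed hUR hc
  -- points of the segment
  have hseg : ∀ x t, (x, t) ∈ D → ∀ η ∈ Set.uIcc (s t) x, (η, t) ∈ D := by
    rintro x t ⟨h1, h2, h3, h4⟩ η hη
    rw [Set.uIcc_of_le h3] at hη
    exact ⟨h1, h2, hη.1, hη.2.trans h4⟩
  have hbd : ∀ t ∈ Set.Icc (0 : ℝ) T, (s t, t) ∈ D := fun t ht =>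
    ⟨ht.1, ht.2, le_rfl, (hrange t ht).2.le⟩
  have hu : ∀ p ∈ D, transformU lam s c =ᶠ[nhds p] transformU lam s₁ c₁ := by
    rintro ⟨x, t⟩ hp
    exact transformU_congr hs₁c (hss t ⟨hp.1, hp.2.1⟩) fun η hη => hcc _ (hseg x t hp η hη)
  have hd1 : ∀ t ∈ Set.Icc (0 : ℝ) T, s' t = deriv s₁ t := fun t ht => by
    rw [← (hss t ht).deriv_eq, (hs' t ht).deriv]
  have hds₁ : ContDiff ℝ 1 (deriv s₁) := by
    have : ContDiff ℝ (1 + 1) s₁ := by simpa [one_add_one_eq_two]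
    exact (contDiff_succ_iff_deriv.1 this).2.2
  have hd2 : ∀ t ∈ Set.Icc (0 : ℝ) T, s'' t = deriv (deriv s₁) t := fun t ht => by
    have h1 := (hs'' t ht).hasDerivWithinAt (s := Set.Icc 0 T)
    have h2 := (hds₁.differentiable (by simp) t).hasDerivAt.hasDerivWithinAt (s := Set.Icc 0 T)
    have h3 := h2.congr hd1 (hd1 t ht)
    exact (uniqueDiffOn_Icc hT t ht).eq_deriv _ h1 h3
  have hux : ∀ p ∈ D, pderivX (transformU lam s c) p = c p + lam := by
    intro p hp
    rw [(pX_congr (hu p hp)).self_of_nhds, global_pX hc₁.continuous, (hcc p hp).self_of_nhds]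
  refine ⟨?_, ?_, ?_, hux, ?_⟩
  · intro p hp
    exact ((global_contDiff hc₁ hs₁).contDiffAt.congr_of_eventuallyEq (hu p hp)).contDiffWithinAt
  · rintro ⟨x, t⟩ hp
    have ht : t ∈ Set.Icc (0 : ℝ) T := ⟨hp.1, hp.2.1⟩
    have hb := hbd t ht
    rw [(pT_congr (pT_congr (hu _ hp))).self_of_nhds,
      (pX_congr (pX_congr (hu _ hp))).self_of_nhds, global_pX hc₁.continuous,
      global_pTT hc₁ hs₁]
    have hfb1 := hfb t ht
    rw [hd1 t ht, hd2 t ht, (pX_congr (hcc _ hb)).self_of_nhds,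
      (pT_congr (hcc _ hb)).self_of_nhds, (hcc _ hb).self_of_nhds, hseq t ht] at hfb1
    have hcx : ContDiff ℝ 1 (pderivX c₁) := contDiff_pX (n := 1) (by simpa [one_add_one_eq_two])
    have hcxd : Differentiable ℝ (pderivX c₁) := hcx.differentiable (by simp)
    have hcxx : Continuous (pderivX (pderivX c₁)) :=
      (contDiff_pX (n := 0) (by simpa using hcx)).continuous
    have hint : ∫ η in (s₁ t)..x, pderivT (pderivT c₁) (η, t)
        = α ^ 2 * (pderivX c₁ (x, t) - pderivX c₁ (s₁ t, t)) := by
      rw [← intervalIntegral.integral_eq_sub_of_hasDerivAt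
        (fun η _ => hasDerivAt_pX hcxd η t)
        ((by fun_prop : Continuous fun η => pderivX (pderivX c₁) (η, t)).intervalIntegrable _ _),
        ← intervalIntegral.integral_const_mul]
      refine intervalIntegral.integral_congr fun η hη => ?_
      rw [← hseq t ht] at hη
      have hm := hseg x t hp η hη
      have := hwave _ hm
      rwa [(pT_congr (pT_congr (hcc _ hm))).self_of_nhds,
        (pX_congr (pX_congr (hcc _ hm))).self_of_nhds] at this
    have hxx : pderivX (fun p => c₁ p + lam) (x, t) = pderivX c₁ (x, t) := by
      simp [pderivX]
    rw [hint, hxx]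
    linear_combination hfb1
  · intro t ht
    simp [transformU]
  · intro t ht
    rw [hux _ (hbd t ht), hkinetic t ht]
    congr 2
    ring
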